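/- Coarse-graining (branching) of charge sectors: let G be a finite commutative group, H a subgroup of G, ψ : H →* ℂˣ a character of H, and F : G → Matrix (Fin n) (Fin n) ℂ any function. Then (Nat.card H : ℂ)⁻¹ • ∑_{h ∈ H} conj (ψ h) • F h = ∑_{χ} （(Fintype.card G : ℂ)⁻¹ • ∑_{g ∈ G} conj (χ g) • F g), where the outer sum runs over all characters χ : G →* ℂˣ whose restriction to H equals ψ (i.e. χ ∘ H.subtype = ψ). In particular, applied to a unitary representation F = U of G, the H-isotype projector for ψ equals the sum of the G-isotype projectors for all characters of G restricting to ψ. -/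

import Mathlib

theorem branching_card {G : Type*} [CommGroup G] [Fintype G] (H : Subgroup G)
    [Fintype (G →* ℂˣ)] [DecidableEq (H →* ℂˣ)] (ψ : H →* ℂˣ) :
    Nat.card H * (Finset.univ.filter (fun χ : G →* ℂˣ => χ.comp H.subtype = ψ)).card
      = Fintype.card G := by
  obtain ⟨χ₀, h₀⟩ := MonoidHom.domRestrict_surjective (G := G) ℂ H ψ
  have h₀' : χ₀.comp H.subtype = ψ := h₀
  have e : (MonoidHom.domRestrictHom H ℂˣ).ker ≃
      {χ // χ ∈ Finset.univ.filter (fun χ : G →* ℂˣ => χ.comp H.subtype = ψ)} :=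
    { toFun := fun k => ⟨χ₀ * k.1, by
        have hk : k.1.comp H.subtype = 1 := k.2
        rw [Finset.mem_filter, MonoidHom.mul_comp, hk, h₀', mul_one]
        exact ⟨Finset.mem_univ _, rfl⟩⟩
      invFun := fun χ => ⟨χ₀⁻¹ * χ.1, by
        have hk : χ.1.comp H.subtype = ψ := (Finset.mem_filter.1 χ.2).2
        have : (χ₀⁻¹ * χ.1).comp H.subtype = 1 := by
          rw [MonoidHom.mul_comp, hk, MonoidHom.inv_comp, h₀', inv_mul_cancel]
        exact this⟩
      left_inv := fun k => by ext1; simp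
      right_inv := fun k => by ext1; simp }
  have h1 := Nat.card_congr e
  rw [CommGroup.card_domRestrictHom_ker] at h1
  rw [Nat.card_eq_fintype_card (α := {χ // χ ∈ _}), Fintype.card_coe] at h1
  rw [← h1, mul_comm, ← Nat.card_eq_fintype_card]
  exact (H.card_eq_card_quotient_mul_card_subgroup).symm

theorem branching_sum_zero {G : Type*} [CommGroup G] [Fintype G] (H : Subgroup G)
    [Fintype (G →* ℂˣ)] [DecidableEq (H →* ℂˣ)] (ψ : H →* ℂˣ) (g : G) (hg : g ∉ H) :
    ∑ χ ∈ Finset.univ.filter (fun χ : G →* ℂˣ => χ.comp H.subtype = ψ), (χ g : ℂ) = 0 := by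
  rw [← CommGroup.forall_monoidHom_apply_eq_one_iff ℂ H g] at hg
  push Not at hg
  obtain ⟨φ, hφ, hne⟩ := hg
  have hφ1 : φ.comp H.subtype = 1 := by
    ext h; simp [hφ h h.2]
  have key : ∑ χ ∈ Finset.univ.filter (fun χ : G →* ℂˣ => χ.comp H.subtype = ψ), (χ g : ℂ)
      = (φ g : ℂ) *
        ∑ χ ∈ Finset.univ.filter (fun χ : G →* ℂˣ => χ.comp H.subtype = ψ), (χ g : ℂ) := by
    rw [Finset.mul_sum]
    symm
    refine Finset.sum_equiv (Equiv.mulLeft φ) (fun χ => ?_) (fun χ _ => by simp)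
    simp [MonoidHom.mul_comp, hφ1]
  have hne' : (φ g : ℂ) - 1 ≠ 0 := by
    rw [sub_ne_zero]
    exact fun h => hne (Units.ext h)
  have : ((φ g : ℂ) - 1) *
      ∑ χ ∈ Finset.univ.filter (fun χ : G →* ℂˣ => χ.comp H.subtype = ψ), (χ g : ℂ) = 0 := by
    rw [sub_mul, one_mul, ← key, sub_self]
  exact (mul_eq_zero.1 this).resolve_left hne'

/-- **Coarse-graining / branching of charge sectors.**  For a finite
commutative group `G`, a subgroup `H`, a character `ψ : H →* ℂˣ` and any matrix-valued
function `F : G → Matrix (Fin n) (Fin n) ℂ`,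
`|H|⁻¹ • ∑_{h ∈ H} conj (ψ h) • F h
  = ∑_{χ : G →* ℂˣ, χ|_H = ψ} |G|⁻¹ • ∑_{g ∈ G} conj (χ g) • F g`. -/
theorem coarse_grained_sector_branching
    {G : Type*} [CommGroup G] [Fintype G] (H : Subgroup G) [Fintype H]
    [Fintype (G →* ℂˣ)] [DecidableEq (H →* ℂˣ)]
    (ψ : H →* ℂˣ) {n : ℕ} (F : G → Matrix (Fin n) (Fin n) ℂ) :
    (Nat.card H : ℂ)⁻¹ • ∑ h : H, star ((ψ h : ℂ)) • F (h : G)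
      = ∑ χ ∈ Finset.univ.filter (fun χ : G →* ℂˣ => χ.comp H.subtype = ψ),
          (Fintype.card G : ℂ)⁻¹ • ∑ g : G, star ((χ g : ℂ)) • F g := by
  classical
  have hc := branching_card H ψ
  have hH : (Nat.card H : ℂ) ≠ 0 := by exact_mod_cast Nat.card_pos.ne'
  have hG : (Fintype.card G : ℂ) ≠ 0 := by exact_mod_cast Fintype.card_ne_zero
  have hc' : (Nat.card H : ℂ) *
      ((Finset.univ.filter (fun χ : G →* ℂˣ => χ.comp H.subtype = ψ)).card : ℂ)
      = Fintype.card G := by exact_mod_cast hc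
  rw [← Finset.smul_sum, Finset.sum_comm]
  simp_rw [← Finset.sum_smul, ← star_sum]
  have hsplit : ∑ g : G, star (∑ χ ∈ Finset.univ.filter
        (fun χ : G →* ℂˣ => χ.comp H.subtype = ψ), (χ g : ℂ)) • F g
      = ∑ h : H, star (∑ χ ∈ Finset.univ.filter
        (fun χ : G →* ℂˣ => χ.comp H.subtype = ψ), (χ (h : G) : ℂ)) • F (h : G) := by
    symm
    refine Finset.sum_of_injOn (fun h : H => (h : G)) Subtype.val_injective.injOn
      (fun _ _ => Finset.mem_coe.2 (Finset.mem_univ _)) (fun g _ hg => ?_) (fun _ _ => rfl)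
    have : g ∉ H := fun h => hg ⟨⟨g, h⟩, by simp, rfl⟩
    rw [branching_sum_zero H ψ g this, star_zero, zero_smul]
  rw [hsplit, Finset.smul_sum, Finset.smul_sum]
  refine Finset.sum_congr rfl fun h _ => ?_
  have hs : ∑ χ ∈ Finset.univ.filter (fun χ : G →* ℂˣ => χ.comp H.subtype = ψ), (χ (h : G) : ℂ)
      = ((Finset.univ.filter (fun χ : G →* ℂˣ => χ.comp H.subtype = ψ)).card : ℂ) * (ψ h : ℂ) := by
    rw [← nsmul_eq_mul, ← Finset.sum_const]
    refine Finset.sum_congr rfl fun χ hχ => ?_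
    rw [← (Finset.mem_filter.1 hχ).2]
    rfl
  rw [hs, star_mul', star_natCast, smul_smul, smul_smul, ← mul_assoc]
  congr 2
  rw [← hc'] at hG ⊢
  have hS := right_ne_zero_of_mul hG
  rw [mul_inv, mul_assoc, inv_mul_cancel₀ hS, mul_one]
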